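/- arXiv:1703.00723 — 3 statements merged into one kernel-verified Lean document; each statement's English description precedes it below -/
import Mathlib

section
/- Assume m2 < m0. There exists a sequence of codes Φ_n of block-length l_n over the finite field F_q with message set F_q^{k_n} such that: (i) k_n / l_n → m0 − m2 as n → ∞; (ii) correctness under passive attack: for every ε > 0 there is N such that for all n ≥ N and all K_B ∈ F_q^{m4×m3} with rank K_B = m0, P_e[Φ_n, K, 0, 0] ≤ ε; and (iii) secrecy against active attacks: for all sufficiently large n, for all natural numbers m5, all K_B ∈ F_q^{m4×m3} with rank K_B = m0, all K_E ∈ F_q^{m2×m3}, all H_B ∈ F_q^{m4×m5}, H_E ∈ F_q^{m2×m5}, and all strategies α^n satisfying the uniqueness condition, the mutual information I(M; Y_E^n) equals 0. -/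
/-- Probability of an event under the uniform distribution on a finite type. -/
noncomputable def prU {Ω : Type*} [Fintype Ω] (E : Ω → Prop) : ℝ :=
  (Nat.card {ω : Ω // E ω} : ℝ) / (Fintype.card Ω : ℝ)

/-- Shannon entropy (natural logarithm) of a random variable on a finite type equipped
with the uniform distribution. -/
noncomputable def entU {Ω A : Type*} [Fintype Ω] [Fintype A] (X : Ω → A) : ℝ :=
  -∑ a : A, prU (fun ω => X ω = a) * Real.log (prU (fun ω => X ω = a))

/-- Shannon mutual information (natural logarithm) of two random variables on a finite type
equipped with the uniform distribution. -/
noncomputable def miU {Ω A B : Type*} [Fintype Ω] [Fintype A] [Fintype B]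
    (X : Ω → A) (Y : Ω → B) : ℝ :=
  entU X + entU Y - entU (fun ω => (X ω, Y ω))

section Entropy

variable {M L B : Type*} [Fintype M] [Fintype L] [Fintype B]

lemma entU_eq_sum_negMulLog {Ω A : Type*} [Fintype Ω] [Fintype A] (X : Ω → A) :
    entU X = ∑ a, Real.negMulLog (prU fun ω => X ω = a) := by
  simp [entU, Real.negMulLog, Finset.sum_neg_distrib]

lemma sum_prU_eq_one {Ω A : Type*} [Fintype Ω] [Nonempty Ω] [Fintype A] (X : Ω → A) :
    ∑ a, prU (fun ω => X ω = a) = 1 := by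
  have h : ∑ a, Nat.card {ω // X ω = a} = Fintype.card Ω := by
    rw [← Nat.card_sigma, Nat.card_congr (Equiv.sigmaFiberEquiv X), Nat.card_eq_fintype_card]
  have hΩ : (Fintype.card Ω : ℝ) ≠ 0 := by simp
  simp only [prU]
  rw [← Finset.sum_div, ← Nat.cast_sum, h, div_self hΩ]

lemma miU_eq_zero_of_prU_eq_mul {Ω A : Type*} [Fintype Ω] [Nonempty Ω] [Fintype A]
    (X : Ω → A) (Y : Ω → B)
    (h : ∀ a b, prU (fun ω => (X ω, Y ω) = (a, b)) =
      prU (fun ω => X ω = a) * prU (fun ω => Y ω = b)) :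
    miU X Y = 0 := by
  simp only [miU, entU_eq_sum_negMulLog]
  rw [Fintype.sum_prod_type]
  simp only [h, Real.negMulLog_mul, Finset.sum_add_distrib, ← Finset.sum_mul, ← Finset.mul_sum,
    sum_prU_eq_one]
  ring

/-- If resampling the scramble can turn the observation for any message into that for any
other message, the observation carries no information about the message. -/
lemma miU_fst_eq_zero [Nonempty M] [Nonempty L] (Y : M × L → B)
    (h : ∀ m m' : M, ∃ σ : L ≃ L, ∀ s, Y (m, σ s) = Y (m', s)) :
    miU (fun ω : M × L => ω.1) Y = 0 := by
  apply miU_eq_zero_of_prU_eq_mul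
  intro a b
  have hc (m : M) : Nat.card {s : L // Y (m, s) = b} = Nat.card {s : L // Y (a, s) = b} := by
    obtain ⟨σ, hσ⟩ := h a m
    exact Nat.card_congr (σ.subtypeEquiv fun s => by rw [hσ])
  have h1 : Nat.card {ω : M × L // (ω.1, Y ω) = (a, b)} = Nat.card {s : L // Y (a, s) = b} :=
    Nat.card_congr
      { toFun := fun ω => ⟨ω.1.2, by
          obtain ⟨⟨m, s⟩, hω⟩ := ω
          have h1 := (Prod.mk.inj hω).1
          have h2 := (Prod.mk.inj hω).2
          subst h1
          exact h2⟩
        invFun := fun s => ⟨(a, s.1), by simp [s.2]⟩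
        left_inv := fun ω => by
          obtain ⟨⟨m, s⟩, hω⟩ := ω
          simp only [Prod.mk.injEq] at hω
          simp [hω.1]
        right_inv := fun s => rfl }
  have h2 : Nat.card {ω : M × L // ω.1 = a} = Fintype.card L := by
    rw [← Nat.card_eq_fintype_card]
    exact Nat.card_congr
      { toFun := fun ω => ω.1.2
        invFun := fun s => ⟨(a, s), rfl⟩
        left_inv := fun ω => by
          obtain ⟨⟨m, s⟩, rfl⟩ := ω
          rfl
        right_inv := fun s => rfl }
  have h3 : Nat.card {ω : M × L // Y ω = b} =
      Fintype.card M * Nat.card {s : L // Y (a, s) = b} := by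
    have e : {ω : M × L // Y ω = b} ≃ Σ m : M, {s : L // Y (m, s) = b} :=
      { toFun := fun ω => ⟨ω.1.1, ω.1.2, ω.2⟩
        invFun := fun p => ⟨(p.1, p.2.1), p.2.2⟩
        left_inv := fun ω => rfl
        right_inv := fun p => rfl }
    rw [Nat.card_congr e, Nat.card_sigma]
    simp [hc]
  have hM : (Fintype.card M : ℝ) ≠ 0 := by simp
  have hL : (Fintype.card L : ℝ) ≠ 0 := by simp
  simp only [prU, h1, h2, h3, Fintype.card_prod, Nat.cast_mul]
  field_simp

end Entropy

section LinearizedPolynomial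

variable (F K : Type*) [Field F] [Fintype F] [Field K] [Algebra F K]

/-- The `F`-linear map `v ↦ ∑ i, c i * v ^ (q ^ (o + i))` on `K`, where `q` is the cardinality
of `F`, as an `F`-linear function of the coefficients `c`. -/
noncomputable def linearizedPoly (o m : ℕ) : (Fin m → K) →ₗ[F] (K →ₗ[F] K) where
  toFun c := ∑ i : Fin m, c i • (FiniteField.frobeniusAlgHom F K ^ (o + i : ℕ)).toLinearMap
  map_add' c d := by simp [add_smul, Finset.sum_add_distrib]
  map_smul' a c := by simp [Finset.smul_sum, smul_assoc]

variable {F K}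

lemma linearizedPoly_apply (o m : ℕ) (c : Fin m → K) (v : K) :
    linearizedPoly F K o m c v = ∑ i : Fin m, c i * v ^ (Fintype.card F ^ (o + i : ℕ)) := by
  simp [linearizedPoly, AlgHom.coe_pow, FiniteField.coe_frobeniusAlgHom, pow_iterate]

lemma linearizedPoly_append (m d : ℕ) (c : Fin m → K) (c' : Fin d → K) :
    linearizedPoly F K 0 (m + d) (Fin.append c c') =
      linearizedPoly F K 0 m c + linearizedPoly F K m d c' := by
  ext v
  simp [linearizedPoly_apply, Fin.sum_univ_add]

/-- A linearized polynomial of `q`-degree less than `m` vanishing on an `m`-dimensional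
subspace is zero. -/
lemma eq_zero_of_linearizedPoly_eq_zero [Finite K] {m : ℕ} (c : Fin m → K)
    (V : Submodule F K) (hV : m ≤ Module.finrank F V)
    (h : ∀ v ∈ V, linearizedPoly F K 0 m c v = 0) : c = 0 := by
  classical
  have hq : 1 < Fintype.card F := Fintype.one_lt_card
  let P : Polynomial K :=
    ∑ i : Fin m, Polynomial.C (c i) * Polynomial.X ^ (Fintype.card F ^ (i : ℕ))
  have hcard : Fintype.card F ^ m ≤ (V : Set K).toFinite.toFinset.card := by
    rw [← Set.ncard_eq_toFinset_card, ← Nat.card_coe_set_eq]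
    change _ ≤ Nat.card V
    rw [Module.natCard_eq_pow_finrank (K := F), Nat.card_eq_fintype_card]
    exact Nat.pow_le_pow_right hq.le hV
  have hdeg : P.degree < (Fintype.card F ^ m : ℕ) := by
    rw [← Polynomial.mem_degreeLT]
    refine Submodule.sum_mem _ fun i _ => ?_
    rw [Polynomial.mem_degreeLT]
    refine (Polynomial.degree_C_mul_X_pow_le _ _).trans_lt ?_
    exact_mod_cast Nat.pow_lt_pow_right hq i.2
  have hP : P = 0 := by
    refine Polynomial.eq_zero_of_degree_lt_of_eval_finset_eq_zero (V : Set K).toFinite.toFinset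
      (hdeg.trans_le (by exact_mod_cast hcard)) fun v hv => ?_
    have := h v (by simpa using hv)
    simpa [linearizedPoly_apply, P, Polynomial.eval_finsetSum] using this
  funext j
  have := congrArg (fun p => p.coeff (Fintype.card F ^ (j : ℕ))) hP
  simpa [P, Polynomial.finsetSum_coeff, Polynomial.coeff_C_mul, Polynomial.coeff_X_pow,
    Nat.pow_right_inj hq, Fin.val_inj] using this

/-- Every linear map agrees on a subspace of dimension at most `m` with some linearized
polynomial of `q`-degree less than `m`. -/
lemma exists_linearizedPoly_eqOn [Finite K] {m : ℕ} (V : Submodule F K)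
    (hV : Module.finrank F V ≤ m) (g : K →ₗ[F] K) :
    ∃ c : Fin m → K, ∀ v ∈ V, linearizedPoly F K 0 m c v = g v := by
  obtain ⟨d, rfl⟩ := Nat.exists_eq_add_of_le hV
  let T : (Fin (Module.finrank F V) → K) →ₗ[F] (V →ₗ[F] K) :=
    (LinearMap.lcomp F K V.subtype) ∘ₗ linearizedPoly F K 0 (Module.finrank F V)
  have hinj : Function.Injective T := by
    rw [← LinearMap.ker_eq_bot, LinearMap.ker_eq_bot']
    intro c hc
    exact eq_zero_of_linearizedPoly_eq_zero c V le_rfl fun v hv => LinearMap.congr_fun hc ⟨v, hv⟩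
  have hsurj : Function.Surjective T :=
    (LinearMap.injective_iff_surjective_of_finrank_eq_finrank (by
      rw [Module.finrank_linearMap, Module.finrank_pi_fintype]
      simp)).1 hinj
  obtain ⟨c, hc⟩ := hsurj (g ∘ₗ V.subtype)
  refine ⟨Fin.append c 0, fun v hv => ?_⟩
  rw [linearizedPoly_append, map_zero, add_zero]
  exact LinearMap.congr_fun hc ⟨v, hv⟩

end LinearizedPolynomial

/-- Nested maximum rank distance codes: a message part `A` and a scramble part `B` such that
any `m2 + d` independent combinations of the rows determine the message, while the scramble can
hide every message from any `m2` combinations of the rows. -/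
lemma exists_nested_rank_metric_code (F : Type*) [Field F] [Fintype F] (m2 d m3 N : ℕ)
    (hN0 : N ≠ 0) (hN : m3 ≤ N) :
    ∃ (A : (Fin (d * N) → F) →ₗ[F] Matrix (Fin m3) (Fin N) F)
      (B : (Fin (m2 * N) → F) →ₗ[F] Matrix (Fin m3) (Fin N) F),
      (∀ {m4 : ℕ} (KB : Matrix (Fin m4) (Fin m3) F), KB.rank = m2 + d →
        ∀ m s, KB * (A m + B s) = 0 → m = 0) ∧
      (∀ (KE : Matrix (Fin m2) (Fin m3) F) (m : Fin (d * N) → F),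
        ∃ s, KE * B s = KE * A m) := by
  obtain ⟨p, hp⟩ := CharP.exists F
  have : Fact p.Prime := ⟨CharP.char_is_prime F p⟩
  have : NeZero N := ⟨hN0⟩
  let K := FiniteField.Extension F p N
  have hK : Module.finrank F K = N := FiniteField.finrank_extension F p N
  have e : K ≃ₗ[F] (Fin N → F) := LinearEquiv.ofFinrankEq _ _ (by simp [hK])
  have eM : (Fin (d * N) → F) ≃ₗ[F] (Fin d → K) := LinearEquiv.ofFinrankEq _ _ (by
    rw [Module.finrank_pi_fintype F (M := fun _ => K)]; simp [hK])
  have eS : (Fin (m2 * N) → F) ≃ₗ[F] (Fin m2 → K) := LinearEquiv.ofFinrankEq _ _ (by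
    rw [Module.finrank_pi_fintype F (M := fun _ => K)]; simp [hK])
  obtain ⟨w, hw⟩ : ∃ w : (Fin m3 → F) →ₗ[F] K, Function.Injective w :=
    finrank_le_iff_exists_linearMap.1 (by simpa [hK] using hN)
  let mat : (K →ₗ[F] K) →ₗ[F] Matrix (Fin m3) (Fin N) F :=
    { toFun := fun f => Matrix.of fun i => e (f (w (Pi.single i 1)))
      map_add' := fun f g => by ext; simp
      map_smul' := fun a f => by ext; simp }
  have mat_apply (f : K →ₗ[F] K) (i : Fin m3) (j : Fin N) :
      mat f i j = e (f (w (Pi.single i 1))) j := rfl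
  have hmat {m : ℕ} (C : Matrix (Fin m) (Fin m3) F) (f : K →ₗ[F] K) (r : Fin m) :
      (C * mat f) r = e (f (w (C r))) := by
    have hr : C r = ∑ i, C r i • (Pi.single i 1 : Fin m3 → F) := pi_eq_sum_univ' (C r)
    rw [hr]
    ext j
    simp [Matrix.mul_apply, mat_apply, map_sum]
  let V {m : ℕ} (C : Matrix (Fin m) (Fin m3) F) : Submodule F K :=
    (Submodule.span F (Set.range C.row)).map w
  have hVrank {m : ℕ} (C : Matrix (Fin m) (Fin m3) F) : Module.finrank F (V C) = C.rank := by
    rw [Matrix.rank_eq_finrank_span_row]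
    exact (Submodule.equivMapOfInjective w hw _).finrank_eq.symm
  have hmem {m : ℕ} (C : Matrix (Fin m) (Fin m3) F) (r : Fin m) : w (C r) ∈ V C :=
    Submodule.mem_map_of_mem (Submodule.subset_span ⟨r, rfl⟩)
  refine ⟨mat ∘ₗ linearizedPoly F K m2 d ∘ₗ eM.toLinearMap,
    mat ∘ₗ linearizedPoly F K 0 m2 ∘ₗ eS.toLinearMap, ?_, ?_⟩
  · intro m4 KB hKB m s h
    have hsum : KB * mat (linearizedPoly F K 0 (m2 + d) (Fin.append (eS s) (eM m))) = 0 := by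
      rw [linearizedPoly_append, map_add, add_comm]
      exact h
    have hle : V KB ≤
        LinearMap.ker (linearizedPoly F K 0 (m2 + d) (Fin.append (eS s) (eM m))) := by
      rw [Submodule.map_le_iff_le_comap, Submodule.span_le]
      rintro _ ⟨r, rfl⟩
      have := congrFun hsum r
      rw [hmat] at this
      exact (LinearEquiv.map_eq_zero_iff e).1 this
    have hc := eq_zero_of_linearizedPoly_eq_zero _ (V KB) (by rw [hVrank, hKB])
      fun v hv => hle hv
    have hm : eM m = 0 := by
      funext i
      simpa using congrFun hc (Fin.natAdd m2 i)
    exact (LinearEquiv.map_eq_zero_iff eM).1 hm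
  · intro KE m
    obtain ⟨c, hc⟩ := exists_linearizedPoly_eqOn (m := m2) (V KE)
      (by rw [hVrank]; simpa using KE.rank_le_height) (linearizedPoly F K m2 d (eM m))
    refine ⟨eS.symm c, ?_⟩
    funext r
    simp only [LinearMap.comp_apply, LinearEquiv.coe_coe, LinearEquiv.apply_symm_apply, hmat]
    rw [hc _ (hmem KE r)]

/-- Prepending an identity matrix to the payload as a training header. -/
def withHeader {F : Type*} [Field F] {m N : ℕ} (P : Matrix (Fin m) (Fin N) F) :
    Matrix (Fin m) (Fin (m + N)) F :=
  fun i => Fin.append ((1 : Matrix (Fin m) (Fin m) F) i) (P i)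

lemma mul_withHeader {F : Type*} [Field F] {m m' N : ℕ} (C : Matrix (Fin m') (Fin m) F)
    (P : Matrix (Fin m) (Fin N) F) :
    C * withHeader P = fun r => Fin.append (C r) ((C * P) r) := by
  funext r j
  refine Fin.addCases (fun j => ?_) (fun j => ?_) j
  · simp [withHeader, Matrix.mul_apply, Matrix.one_apply]
  · simp [withHeader, Matrix.mul_apply]

lemma mul_withHeader_inj {F : Type*} [Field F] {m m' N : ℕ} {C C' : Matrix (Fin m') (Fin m) F}
    {P P' : Matrix (Fin m) (Fin N) F} :
    C * withHeader P = C' * withHeader P' ↔ C = C' ∧ C * P = C' * P' := by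
  rw [mul_withHeader, mul_withHeader]
  refine ⟨fun h => ⟨?_, ?_⟩, fun ⟨h, h'⟩ => by rw [h', h]⟩
  · ext r j
    simpa using congrFun (congrFun h r) (Fin.castAdd N j)
  · ext r j
    simpa using congrFun (congrFun h r) (Fin.natAdd m j)

/-- A code of block length `m3 + N` with zero error and perfect secrecy. -/
lemma exists_zero_error_perfectly_secret_code (F : Type*) [Field F] [Fintype F]
    (m2 d m3 m4 N : ℕ) (hN0 : N ≠ 0) (hN : m3 ≤ N) :
    ∃ (LL : ℕ) (_ : 0 < LL)
      (enc : (Fin (d * N) → F) → Fin LL → Matrix (Fin m3) (Fin (m3 + N)) F)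
      (dec : Matrix (Fin m4) (Fin (m3 + N)) F → (Fin (d * N) → F)),
      (∀ KB : Matrix (Fin m4) (Fin m3) F, KB.rank = m2 + d →
        ∀ m s, dec (KB * enc m s) = m) ∧
      (∀ (KE : Matrix (Fin m2) (Fin m3) F) (m m' : Fin (d * N) → F),
        ∃ σ : Fin LL ≃ Fin LL, ∀ s, KE * enc m (σ s) = KE * enc m' s) := by
  classical
  obtain ⟨A, B, hdec, hsec⟩ := exists_nested_rank_metric_code F m2 d m3 N hN0 hN
  let e := Fintype.equivFin (Fin (m2 * N) → F)
  let enc (m : Fin (d * N) → F) (s : Fin (Fintype.card (Fin (m2 * N) → F))) :=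
    withHeader (A m + B (e.symm s))
  have hdec' : ∀ Y : Matrix (Fin m4) (Fin (m3 + N)) F, ∃ m, ∀ KB : Matrix (Fin m4) (Fin m3) F,
      KB.rank = m2 + d → ∀ m' s, Y = KB * enc m' s → m = m' := by
    intro Y
    by_cases h : ∃ KB : Matrix (Fin m4) (Fin m3) F, KB.rank = m2 + d ∧ ∃ m s, Y = KB * enc m s
    · obtain ⟨KB, hKB, m, s, rfl⟩ := h
      refine ⟨m, fun KB' _ m' s' h => ?_⟩
      obtain ⟨rfl, h⟩ := mul_withHeader_inj.1 h
      refine sub_eq_zero.1 (hdec KB hKB (m - m') (e.symm s - e.symm s') ?_)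
      rw [map_sub, map_sub, sub_add_sub_comm, Matrix.mul_sub, h, sub_self]
    · exact ⟨0, fun KB hKB m s hY => (h ⟨KB, hKB, m, s, hY⟩).elim⟩
  choose dec hdec' using hdec'
  refine ⟨_, Fintype.card_pos, enc, dec, fun KB hKB m s => hdec' _ KB hKB m s rfl, ?_⟩
  intro KE m m'
  obtain ⟨t, ht⟩ := hsec KE (m' - m)
  refine ⟨(e.symm.trans (Equiv.addRight t)).trans e, fun s => mul_withHeader_inj.2 ⟨rfl, ?_⟩⟩
  simp only [Equiv.trans_apply, Equiv.symm_apply_apply, Equiv.coe_addRight, map_add,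
    Matrix.mul_add, ht, map_sub, Matrix.mul_sub]
  abel

/-- if `m2 < m0` there is a sequence of codes of block-length `l n` with
message set `F^(k n)` whose rate tends to `m0 - m2`, which is correct under passive attacks,
and which for all sufficiently large `n` leaks no information to Eve under any active attack
satisfying the uniqueness condition. -/
theorem exists_secure_code_sequence_with_passive_correctness
    (F : Type) [Field F] [Fintype F]
    (m0 m2 m3 m4 : ℕ) (hm : m2 < m0) :
    ∃ (l k LL : ℕ → ℕ), (∀ n, 0 < l n) ∧ (∀ n, 0 < LL n) ∧
      ∃ (enc : ∀ n : ℕ, (Fin (k n) → F) → Fin (LL n) → Matrix (Fin m3) (Fin (l n)) F)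
        (dec : ∀ n : ℕ, Matrix (Fin m4) (Fin (l n)) F → (Fin (k n) → F)),
        Filter.Tendsto (fun n => (k n : ℝ) / (l n : ℝ)) Filter.atTop
          (nhds ((m0 : ℝ) - (m2 : ℝ))) ∧
        (∀ ε : ℝ, 0 < ε → ∃ N : ℕ, ∀ n, N ≤ n →
          ∀ KB : Matrix (Fin m4) (Fin m3) F, KB.rank = m0 →
            prU (fun ω : (Fin (k n) → F) × Fin (LL n) =>
              dec n (KB * enc n ω.1 ω.2) ≠ ω.1) ≤ ε) ∧
        (∃ N : ℕ, ∀ n, N ≤ n →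
          ∀ (m5 : ℕ)
            (KB : Matrix (Fin m4) (Fin m3) F) (KE : Matrix (Fin m2) (Fin m3) F)
            (HB : Matrix (Fin m4) (Fin m5) F) (HE : Matrix (Fin m2) (Fin m5) F),
            KB.rank = m0 →
            ∀ (αn : Matrix (Fin m2) (Fin (l n)) F → Matrix (Fin m5) (Fin (l n)) F),
              (∀ x : Matrix (Fin m3) (Fin (l n)) F,
                ∃! y : Matrix (Fin m2) (Fin (l n)) F, y = KE * x + HE * αn y) →
              ∀ (YE : (Fin (k n) → F) × Fin (LL n) → Matrix (Fin m2) (Fin (l n)) F),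
                (∀ ω, YE ω = KE * enc n ω.1 ω.2 + HE * αn (YE ω)) →
                miU (fun ω : (Fin (k n) → F) × Fin (LL n) => ω.1) YE = 0) := by
  obtain ⟨d, rfl⟩ := Nat.exists_eq_add_of_le hm.le
  let N (n : ℕ) : ℕ := n + m3 + 1
  choose LL hLL enc dec hdec hsec using fun n =>
    exists_zero_error_perfectly_secret_code F m2 d m3 m4 (N n) (by simp [N]) (by simp [N]; omega)
  refine ⟨fun n => m3 + N n, fun n => d * N n, LL, fun n => by simp [N], hLL, enc, dec, ?_, ?_,
    0, ?_⟩
  · have hN : Filter.Tendsto (fun n => (N n : ℝ)) Filter.atTop Filter.atTop :=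
      tendsto_natCast_atTop_atTop.comp
        (Filter.tendsto_atTop_mono (fun n => by simp [N]; omega) Filter.tendsto_id)
    have h0 : Filter.Tendsto (fun n => (d : ℝ) / ((m3 : ℝ) / (N n : ℝ) + 1)) Filter.atTop
        (nhds ((d : ℝ) / (0 + 1))) :=
      tendsto_const_nhds.div ((hN.const_div_atTop (m3 : ℝ)).add_const 1) (by norm_num)
    have hlim : (((m2 + d : ℕ) : ℝ) - m2) = (d : ℝ) / (0 + 1) := by
      push_cast
      ring
    rw [hlim]
    refine h0.congr fun n => ?_
    have hpos : (N n : ℝ) ≠ 0 := by positivity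
    push_cast
    field_simp
  · refine fun ε hε => ⟨0, fun n _ KB hKB => ?_⟩
    simp only [hdec n KB hKB, ne_eq, not_true_eq_false, prU]
    simpa using hε.le
  · intro n _ m5 KB KE HB HE _ αn hα YE hYE
    have : Nonempty (Fin (LL n)) := ⟨⟨0, hLL n⟩⟩
    refine miU_fst_eq_zero YE fun m m' => ?_
    obtain ⟨σ, hσ⟩ := hsec n KE m m'
    refine ⟨σ, fun s => (hα (enc n m' s)).unique ?_ (hYE (m', s))⟩
    rw [← hσ]
    exact hYE (m, σ s)
end

section
/- Assume m2 < m0. There exists a sequence of codes Φ_n of block-length l_n over the finite field F_q with message set F_q^{k_n} such that: (i) k_n / l_n → m0 − m2 as n → ∞; (ii) for all sufficiently large n, for all K_B ∈ F_q^{m4×m3} with rank K_B = m0 and all K_E ∈ F_q^{m2×m3}, the leaked information under passive attack satisfies I(M; K_E X^n) = 0; and (iii) for every ε > 0 there is N such that for all n ≥ N and all K_B ∈ F_q^{m4×m3} with rank K_B = m0, P_e[Φ_n, K, 0, 0] ≤ ε. -/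
section LinearizedPolynomial

variable (F E : Type) [Field F] [Fintype F] [Field E] [Algebra F E]

/-- The linearized polynomial map `x ↦ ∑ j, u j * x ^ (q ^ j)`, with `q` the cardinality of `F`,
as a function of the coefficient vector `u`. -/
noncomputable def linearizedMap (n : ℕ) : (Fin n → E) →ₗ[E] (E →ₗ[F] E) :=
  Fintype.linearCombination E fun j : Fin n =>
    ((FiniteField.frobeniusAlgHom F E) ^ (j : ℕ)).toLinearMap

variable {F E}

theorem linearizedMap_apply {n : ℕ} (u : Fin n → E) (x : E) :
    linearizedMap F E n u x = ∑ j, u j * x ^ (Fintype.card F ^ (j : ℕ)) := by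
  simp [linearizedMap, Fintype.linearCombination_apply, LinearMap.sum_apply,
    AlgHom.coe_pow, FiniteField.coe_frobeniusAlgHom, pow_iterate]

theorem linearizedMap_append_zero {n m : ℕ} (u : Fin n → E) :
    linearizedMap F E (n + m) (Fin.append u 0) = linearizedMap F E n u := by
  ext x
  simp [linearizedMap_apply, Fin.sum_univ_add]

variable [Module.Finite F E]

theorem eq_zero_of_linearizedMap_eq_zero {n : ℕ} {u : Fin n → E} (W : Submodule F E)
    (hW : n ≤ Module.finrank F W) (h : ∀ x ∈ W, linearizedMap F E n u x = 0) : u = 0 := by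
  classical
  have : Finite E := Module.finite_of_finite F
  have := Fintype.ofFinite W
  set q := Fintype.card F with hq
  have hq1 : 1 < q := Fintype.one_lt_card
  set p : Polynomial E := ∑ j : Fin n, Polynomial.monomial (q ^ (j : ℕ)) (u j) with hp
  have hcoeff : ∀ j : Fin n, p.coeff (q ^ (j : ℕ)) = u j := by
    intro j
    rw [hp, Polynomial.finsetSum_coeff, Finset.sum_eq_single j]
    · simp
    · intro i _ hij
      rw [Polynomial.coeff_monomial, if_neg]
      intro h
      exact hij (Fin.ext (Nat.pow_right_injective hq1 h))
    · simp
  have hdeg : p.degree < (q ^ n : ℕ) := by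
    refine (Polynomial.degree_sum_le _ _).trans_lt ?_
    rw [Finset.sup_lt_iff (WithBot.bot_lt_coe _)]
    intro j _
    refine (Polynomial.degree_monomial_le _ _).trans_lt ?_
    exact_mod_cast Nat.pow_lt_pow_right hq1 j.2
  have hcard : q ^ n ≤ Fintype.card W := by
    rw [Module.card_eq_pow_finrank (K := F) (V := W)]
    exact Nat.pow_le_pow_right hq1.le hW
  have hp0 : p = 0 := by
    by_contra hne
    have hd : p.natDegree < Fintype.card W :=
      ((Polynomial.natDegree_lt_iff_degree_lt hne).2 hdeg).trans_le hcard
    refine hne (Polynomial.eq_zero_of_natDegree_lt_card_of_eval_eq_zero p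
      (f := fun w : W => (w : E)) Subtype.val_injective (fun w => ?_) hd)
    rw [← h w w.2, linearizedMap_apply, hp, Polynomial.eval_finsetSum]
    simp [hq]
  ext j
  rw [← hcoeff j, hp0]
  simp

theorem exists_linearizedMap_eqOn {n : ℕ} (W : Submodule F E) (hW : Module.finrank F W ≤ n)
    (f : E →ₗ[F] E) : ∃ u : Fin n → E, ∀ x ∈ W, linearizedMap F E n u x = f x := by
  obtain ⟨e, rfl⟩ := Nat.exists_eq_add_of_le hW
  let T : (Fin (Module.finrank F W) → E) →ₗ[E] (W →ₗ[F] E) :=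
    { toFun := fun u => (linearizedMap F E _ u).comp W.subtype
      map_add' := fun u v => by ext; simp
      map_smul' := fun c u => by ext; simp }
  have hinj : Function.Injective T := by
    rw [← LinearMap.ker_eq_bot, LinearMap.ker_eq_bot']
    intro u hu
    exact eq_zero_of_linearizedMap_eq_zero W le_rfl fun x hx =>
      LinearMap.congr_fun hu (⟨x, hx⟩ : W)
  have hsurj : Function.Surjective T := by
    refine (LinearMap.injective_iff_surjective_of_finrank_eq_finrank ?_).1 hinj
    rw [Module.finrank_linearMap_self, Module.finrank_fin_fun]
  obtain ⟨u, hu⟩ := hsurj (f.comp W.subtype)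
  refine ⟨Fin.append u 0, fun x hx => ?_⟩
  rw [linearizedMap_append_zero]
  exact LinearMap.congr_fun hu (⟨x, hx⟩ : W)

end LinearizedPolynomial

theorem Matrix.finrank_span_range_sum_smul {F E m n : Type*} [Field F] [AddCommGroup E] [Module F E]
    [Fintype m] [Fintype n] (K : Matrix m n F) {g : n → E} (hg : LinearIndependent F g) :
    Module.finrank F (Submodule.span F (Set.range fun i => ∑ j, K i j • g j)) = K.rank := by
  rw [Matrix.rank_eq_finrank_span_row]
  have hinj : Function.Injective (Fintype.linearCombination F g) :=
    linearIndependent_iff_injective_fintypeLinearCombination.1 hg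
  rw [((Submodule.span F (Set.range K.row)).equivMapOfInjective _ hinj).finrank_eq,
    Submodule.map_span, ← Set.range_comp]
  rfl

theorem miU_fst_eq_zero_s6 {A B C : Type*} [Fintype A] [Fintype B] [Fintype C] [Nonempty A]
    [Nonempty B] (Y : A × B → C)
    (hY : ∀ a a' c, Nat.card {b // Y (a, b) = c} = Nat.card {b // Y (a', b) = c}) :
    miU (fun ω : A × B => ω.1) Y = 0 := by
  classical
  obtain ⟨a₀⟩ := ‹Nonempty A›
  set r : C → ℝ := fun c => (Nat.card {b // Y (a₀, b) = c} : ℝ) / Fintype.card B with hr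
  have hA : (Fintype.card A : ℝ) ≠ 0 := by
    have : Nonempty A := ⟨a₀⟩
    exact_mod_cast Fintype.card_ne_zero
  have hB : (Fintype.card B : ℝ) ≠ 0 := by exact_mod_cast Fintype.card_ne_zero
  have hXY : ∀ a c, prU (fun ω : A × B => (ω.1, Y ω) = (a, c)) =
      (Fintype.card A : ℝ)⁻¹ * r c := by
    intro a c
    have e : {ω : A × B // (ω.1, Y ω) = (a, c)} ≃ {b // Y (a, b) = c} :=
      { toFun := fun ω => ⟨ω.1.2, by
          obtain ⟨⟨x, b⟩, h⟩ := ω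
          simp only [Prod.mk.injEq] at h
          exact h.1 ▸ h.2⟩
        invFun := fun b => ⟨(a, b.1), by simp [b.2]⟩
        left_inv := by
          rintro ⟨⟨x, b⟩, h⟩
          simp only [Prod.mk.injEq] at h
          simp [h.1]
        right_inv := fun b => rfl }
    simp only [prU, hr]
    rw [Nat.card_congr e, hY a a₀ c, Fintype.card_prod]
    push_cast
    field_simp
  have hX : ∀ a, prU (fun ω : A × B => ω.1 = a) = (Fintype.card A : ℝ)⁻¹ := by
    intro a
    have e : {ω : A × B // ω.1 = a} ≃ B :=
      { toFun := fun ω => ω.1.2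
        invFun := fun b => ⟨(a, b), rfl⟩
        left_inv := by
          rintro ⟨⟨x, b⟩, h⟩
          simp only at h
          simp [h]
        right_inv := fun b => rfl }
    simp only [prU]
    rw [Nat.card_congr e, Fintype.card_prod, Nat.card_eq_fintype_card]
    push_cast
    field_simp
  have hYc : ∀ c, prU (fun ω : A × B => Y ω = c) = r c := by
    intro c
    have e : {ω : A × B // Y ω = c} ≃ Σ a : A, {b // Y (a, b) = c} :=
      { toFun := fun ω => ⟨ω.1.1, ω.1.2, ω.2⟩
        invFun := fun s => ⟨(s.1, s.2.1), s.2.2⟩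
        left_inv := fun ω => rfl
        right_inv := fun s => rfl }
    simp only [prU, hr]
    rw [Nat.card_congr e, Nat.card_sigma, Finset.sum_congr rfl fun a _ => hY a a₀ c,
      Fintype.card_prod]
    simp only [Finset.sum_const, Finset.card_univ, smul_eq_mul]
    push_cast
    field_simp
  have hsum : ∑ c, r c = 1 := by
    have e : B ≃ Σ c : C, {b // Y (a₀, b) = c} := (Equiv.sigmaFiberEquiv _).symm
    have h := Nat.card_congr e
    rw [Nat.card_sigma, Nat.card_eq_fintype_card] at h
    rw [hr, ← Finset.sum_div, div_eq_one_iff_eq hB, h]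
    push_cast
    rfl
  have h1 : entU (fun ω : A × B => ω.1) =
      Fintype.card A * Real.negMulLog (Fintype.card A : ℝ)⁻¹ := by
    simp only [entU, hX]
    simp [Real.negMulLog]
  have h2 : entU Y = ∑ c, Real.negMulLog (r c) := by
    simp only [entU, hYc]
    simp [Real.negMulLog, Finset.sum_neg_distrib]
  have h3 : entU (fun ω : A × B => (ω.1, Y ω)) =
      Fintype.card A * Real.negMulLog (Fintype.card A : ℝ)⁻¹ + ∑ c, Real.negMulLog (r c) := by
    have : entU (fun ω : A × B => (ω.1, Y ω)) =
        ∑ x : A × C, Real.negMulLog ((Fintype.card A : ℝ)⁻¹ * r x.2) := by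
      rw [entU, ← Finset.sum_neg_distrib]
      refine Finset.sum_congr rfl fun x _ => ?_
      rw [show x = (x.1, x.2) from rfl, hXY]
      simp [Real.negMulLog]
    rw [this, Fintype.sum_prod_type]
    simp only [Real.negMulLog_mul, Finset.sum_add_distrib, ← Finset.sum_mul, ← Finset.mul_sum,
      hsum, Finset.sum_const, Finset.card_univ, nsmul_eq_mul, one_mul]
    rw [mul_inv_cancel₀ hA, one_mul]
  rw [miU, h1, h2, h3]
  ring

theorem exists_zero_error_secure_code (F : Type) [Field F] [Fintype F] (d m2 m3 m4 N : ℕ)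
    (hN : 0 < N) (h3 : m3 ≤ N) :
    ∃ LL : ℕ, 0 < LL ∧
      ∃ (enc : (Fin (d * N) → F) → Fin LL → Matrix (Fin m3) (Fin (m3 + N)) F)
        (dec : Matrix (Fin m4) (Fin (m3 + N)) F → (Fin (d * N) → F)),
        (∀ KE : Matrix (Fin m2) (Fin m3) F,
          miU (fun ω : (Fin (d * N) → F) × Fin LL => ω.1)
            (fun ω : (Fin (d * N) → F) × Fin LL => KE * enc ω.1 ω.2) = 0) ∧
        ∀ KB : Matrix (Fin m4) (Fin m3) F, KB.rank = m2 + d →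
          ∀ M S, dec (KB * enc M S) = M := by
  classical
  obtain ⟨p, hp⟩ := CharP.exists F
  have : Fact p.Prime := ⟨CharP.char_is_prime F p⟩
  have : NeZero N := ⟨hN.ne'⟩
  let E := FiniteField.Extension F p N
  have hE : Module.finrank F E = N := FiniteField.finrank_extension F p N
  have := Fintype.ofFinite E
  let b : Module.Basis (Fin N) F E := Module.finBasisOfFinrankEq F E hE
  let g : Fin m3 → E := fun i => b (Fin.castLE h3 i)
  have hg : LinearIndependent F g := b.linearIndependent.comp _ (Fin.castLE_injective h3)
  have hcE : Fintype.card E = Fintype.card F ^ N := by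
    rw [Module.card_eq_pow_finrank (K := F), hE]
  let eM : (Fin (d * N) → F) ≃ (Fin d → E) := Fintype.equivOfCardEq (by
    simp only [Fintype.card_fun, Fintype.card_fin, hcE, ← pow_mul, mul_comm])
  let eS : Fin (Fintype.card (Fin m2 → E)) ≃ (Fin m2 → E) := (Fintype.equivFin _).symm
  let f : (Fin d → E) → (Fin m2 → E) → E →ₗ[F] E :=
    fun t s => linearizedMap F E (m2 + d) (Fin.append s t)
  let X : (Fin d → E) → (Fin m2 → E) → Matrix (Fin m3) (Fin (m3 + N)) F :=
    fun t s => Matrix.of fun i => Fin.append (Pi.single i 1) (b.equivFun (f t s (g i)))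
  have hX : ∀ {m : ℕ} (K : Matrix (Fin m) (Fin m3) F) t s i,
      (K * X t s) i = Fin.append (K i) (b.equivFun (f t s (∑ j, K i j • g j))) := by
    intro m K t s i
    ext c
    refine Fin.addCases (fun c => ?_) (fun c => ?_) c
    · simp [X, Matrix.mul_apply, Pi.single_apply]
    · simp [X, Matrix.mul_apply]
  have hX_inj : ∀ (K K' : Matrix (Fin m4) (Fin m3) F) t s t' s', K.rank = m2 + d →
      K * X t s = K' * X t' s' → t = t' := by
    intro K K' t s t' s' hK h
    have hrow : ∀ i, Fin.append (K i) (b.equivFun (f t s (∑ j, K i j • g j))) =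
        Fin.append (K' i) (b.equivFun (f t' s' (∑ j, K' i j • g j))) := by
      intro i
      rw [← hX, ← hX, h]
    have hKK : K = K' := by
      ext i j
      simpa using congrFun (hrow i) (Fin.castAdd N j)
    subst hKK
    have hval : ∀ i, f t s (∑ j, K i j • g j) = f t' s' (∑ j, K i j • g j) := by
      intro i
      refine b.equivFun.injective (funext fun c => ?_)
      simpa using congrFun (hrow i) (Fin.natAdd m3 c)
    have hz : Fin.append s t - Fin.append s' t' = 0 := by
      refine eq_zero_of_linearizedMap_eq_zero (F := F)
        (Submodule.span F (Set.range fun i => ∑ j, K i j • g j)) ?_ ?_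
      · rw [Matrix.finrank_span_range_sum_smul K hg, hK]
      · intro x hx
        refine (Submodule.span_le (p := LinearMap.ker (linearizedMap F E (m2 + d)
          (Fin.append s t - Fin.append s' t')))).2 ?_ hx
        rintro _ ⟨i, rfl⟩
        rw [SetLike.mem_coe, LinearMap.mem_ker, map_sub, LinearMap.sub_apply, sub_eq_zero]
        exact hval i
    ext j
    simpa [sub_eq_zero] using congrFun hz (Fin.natAdd m2 j)
  have hX_shift : ∀ (K : Matrix (Fin m2) (Fin m3) F) t t', ∃ v, ∀ s,
      K * X t s = K * X t' (s + v) := by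
    intro K t t'
    let W := Submodule.span F (Set.range fun i => ∑ j, K i j • g j)
    have hW : Module.finrank F W ≤ m2 := by
      exact (finrank_range_le_card (R := F) fun i => ∑ j, K i j • g j).trans_eq
        (Fintype.card_fin m2)
    obtain ⟨v, hv⟩ := exists_linearizedMap_eqOn W hW (f (t - t') 0)
    refine ⟨v, fun s => ?_⟩
    have key : ∀ x ∈ W, f t s x = f t' (s + v) x := by
      intro x hx
      have h := hv x hx
      simp only [f, linearizedMap_apply, Fin.sum_univ_add, Fin.append_left, Fin.append_right,
        Pi.add_apply, Pi.sub_apply, Pi.zero_apply, add_mul, sub_mul, zero_mul,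
        Finset.sum_add_distrib, Finset.sum_sub_distrib, Finset.sum_const_zero, Fin.val_castAdd] at h ⊢
      rw [h]
      ring
    ext i c
    rw [hX, hX, key _ (Submodule.subset_span ⟨i, rfl⟩)]
  refine ⟨Fintype.card (Fin m2 → E), Fintype.card_pos, fun M S => X (eM M) (eS S),
    fun Y => if h : ∃ (M : Fin (d * N) → F) (K : Matrix (Fin m4) (Fin m3) F) (s : Fin m2 → E),
      K.rank = m2 + d ∧ Y = K * X (eM M) s then h.choose else 0, fun KE => ?_, ?_⟩
  · have : NeZero (Fintype.card (Fin m2 → E)) := ⟨Fintype.card_ne_zero⟩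
    refine miU_fst_eq_zero_s6 _ fun M M' c => ?_
    obtain ⟨v, hv⟩ := hX_shift KE (eM M) (eM M')
    refine Nat.card_congr
      (((eS.trans (Equiv.addRight v)).trans eS.symm).subtypeEquiv fun S => ?_)
    simp [hv]
  · intro KB hKB M S
    have h : ∃ (M' : Fin (d * N) → F) (K : Matrix (Fin m4) (Fin m3) F) (s : Fin m2 → E),
      K.rank = m2 + d ∧ KB * X (eM M) (eS S) = K * X (eM M') s := ⟨M, KB, eS S, hKB, rfl⟩
    simp only
    rw [dif_pos h]
    obtain ⟨K, s, _, hs⟩ := h.choose_spec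
    exact (eM.injective (hX_inj _ _ _ _ _ _ hKB hs)).symm

/-- if `m2 < m0` there is a sequence of codes of block-length `l n` with
message set `F^(k n)` whose rate tends to `m0 - m2`, which for all sufficiently large `n`
leaks no information under passive attacks, and which is correct under passive attacks. -/
theorem exists_passively_secure_code_sequence
    (F : Type) [Field F] [Fintype F]
    (m0 m2 m3 m4 : ℕ) (hm : m2 < m0) :
    ∃ (l k LL : ℕ → ℕ), (∀ n, 0 < l n) ∧ (∀ n, 0 < LL n) ∧
      ∃ (enc : ∀ n : ℕ, (Fin (k n) → F) → Fin (LL n) → Matrix (Fin m3) (Fin (l n)) F)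
        (dec : ∀ n : ℕ, Matrix (Fin m4) (Fin (l n)) F → (Fin (k n) → F)),
        Filter.Tendsto (fun n => (k n : ℝ) / (l n : ℝ)) Filter.atTop
          (nhds ((m0 : ℝ) - (m2 : ℝ))) ∧
        (∃ N : ℕ, ∀ n, N ≤ n →
          ∀ (KB : Matrix (Fin m4) (Fin m3) F) (KE : Matrix (Fin m2) (Fin m3) F),
            KB.rank = m0 →
            miU (fun ω : (Fin (k n) → F) × Fin (LL n) => ω.1)
              (fun ω : (Fin (k n) → F) × Fin (LL n) => KE * enc n ω.1 ω.2) = 0) ∧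
        (∀ ε : ℝ, 0 < ε → ∃ N : ℕ, ∀ n, N ≤ n →
          ∀ KB : Matrix (Fin m4) (Fin m3) F, KB.rank = m0 →
            prU (fun ω : (Fin (k n) → F) × Fin (LL n) =>
              dec n (KB * enc n ω.1 ω.2) ≠ ω.1) ≤ ε) := by
  obtain ⟨d, rfl⟩ := Nat.exists_eq_add_of_le hm.le
  have H := fun n : ℕ => exists_zero_error_secure_code F d m2 m3 m4 (m3 + n + 1)
    (Nat.succ_pos _) (by omega)
  choose LL hLL enc dec hsec hdec using H
  refine ⟨fun n => m3 + (m3 + n + 1), fun n => d * (m3 + n + 1), LL, fun n => Nat.succ_pos _, hLL,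
    enc, dec, ?_, ⟨0, fun n _ _ KE _ => hsec n KE⟩, fun ε hε => ⟨0, fun n _ KB hKB => ?_⟩⟩
  · have h : Filter.Tendsto (fun n : ℕ => (d : ℝ) - d * m3 * (1 / ((n : ℝ) + (2 * m3 + 1))))
        Filter.atTop (nhds ((d : ℝ) - d * m3 * 0)) := by
      refine tendsto_const_nhds.sub (Filter.Tendsto.const_mul _ ?_)
      simp only [one_div]
      exact tendsto_inv_atTop_zero.comp
        (Filter.tendsto_atTop_add_const_right _ _ tendsto_natCast_atTop_atTop)
    convert h using 2 with n
    · push_cast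
      have : (n : ℝ) + (2 * m3 + 1) ≠ 0 := by positivity
      have : (m3 : ℝ) + (m3 + n + 1) ≠ 0 := by positivity
      field_simp
      ring
    · push_cast
      ring
  · simp [prU, hdec n KB hKB, hε.le]
end

section
/- Let M, Y1, Y2 be random variables on a finite probability space with Y1, Y2 taking values in Z_d, let (Y3, Y4) be a deterministic function of (Y1, Y2), and suppose M is a deterministic function of (Y3, Y4). Then max over i ∈ {1,2} and j ∈ {3,4} of I(M; (Y_i, Y_j)) is at least H(M) − (1/2)·log d. In particular, if M is uniformly distributed on Z_d then this maximum is at least (1/2)·log d, and if I(M; (Y_i, Y_j)) = 0 for all four pairs then H(M) ≤ (1/2)·log d. -/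
open scoped Classical in
/-- Probability of an event under a probability mass function `P` on a finite type. -/
noncomputable def prW {Ω : Type*} [Fintype Ω] (P : Ω → ℝ) (E : Ω → Prop) : ℝ :=
  ∑ ω : Ω, if E ω then P ω else 0

/-- Shannon entropy (natural logarithm) of a random variable on a finite probability
space with probability mass function `P`. -/
noncomputable def entW {Ω A : Type*} [Fintype Ω] [Fintype A] (P : Ω → ℝ) (X : Ω → A) : ℝ :=
  -∑ a : A, prW P (fun ω => X ω = a) * Real.log (prW P (fun ω => X ω = a))

/-- Shannon mutual information (natural logarithm). -/
noncomputable def miW {Ω A B : Type*} [Fintype Ω] [Fintype A] [Fintype B]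
    (P : Ω → ℝ) (X : Ω → A) (Y : Ω → B) : ℝ :=
  entW P X + entW P Y - entW P (fun ω => (X ω, Y ω))

theorem sum_prW_mul {Ω A : Type*} [Fintype Ω] [Fintype A] (P : Ω → ℝ) (X : Ω → A) (f : A → ℝ) :
    ∑ a, prW P (fun ω => X ω = a) * f a = ∑ ω, P ω * f (X ω) := by
  classical
  simp only [prW, Finset.sum_mul, ite_mul, zero_mul]
  rw [Finset.sum_comm]
  simp

theorem prW_nonneg {Ω : Type*} [Fintype Ω] {P : Ω → ℝ} (hP : ∀ ω, 0 ≤ P ω) (E : Ω → Prop) :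
    0 ≤ prW P E :=
  Finset.sum_nonneg fun ω _ => by split_ifs <;> simp [hP ω]

theorem prW_mono {Ω : Type*} [Fintype Ω] {P : Ω → ℝ} (hP : ∀ ω, 0 ≤ P ω) {E F : Ω → Prop}
    (h : ∀ ω, E ω → F ω) : prW P E ≤ prW P F := by
  refine Finset.sum_le_sum fun ω _ => ?_
  by_cases hE : E ω
  · simp [hE, h ω hE]
  · simp only [hE, if_false]
    split_ifs <;> simp [hP ω]

theorem le_prW {Ω : Type*} [Fintype Ω] {P : Ω → ℝ} (hP : ∀ ω, 0 ≤ P ω) {E : Ω → Prop} {ω : Ω}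
    (h : E ω) : P ω ≤ prW P E := by
  unfold prW
  refine le_trans (le_of_eq ?_) (Finset.single_le_sum (fun ω' _ => ?_) (Finset.mem_univ ω))
  · simp [h]
  · split_ifs <;> simp [hP ω']

theorem sum_prW_pair {Ω A B : Type*} [Fintype Ω] [Fintype B] (P : Ω → ℝ) (X : Ω → A)
    (Y : Ω → B) (a : A) :
    ∑ b, prW P (fun ω => (X ω, Y ω) = (a, b)) = prW P (fun ω => X ω = a) := by
  classical
  simp only [prW]
  rw [Finset.sum_comm]
  refine Finset.sum_congr rfl fun ω _ => ?_
  by_cases h : X ω = a <;> simp [h]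

theorem sum_prW {Ω A : Type*} [Fintype Ω] [Fintype A] (P : Ω → ℝ) (X : Ω → A) :
    ∑ a, prW P (fun ω => X ω = a) = ∑ ω, P ω := by
  simpa using sum_prW_mul P X (fun _ => 1)

theorem entW_eq_sum {Ω A : Type*} [Fintype Ω] [Fintype A] (P : Ω → ℝ) (X : Ω → A) :
    entW P X = -∑ ω, P ω * Real.log (prW P (fun ω' => X ω' = X ω)) := by
  rw [entW, sum_prW_mul P X (fun a => Real.log (prW P (fun ω => X ω = a)))]

/-- Entropy does not increase under deterministic maps. -/
theorem entW_le_of_determined {Ω A B : Type*} [Fintype Ω] [Fintype A] [Fintype B] {P : Ω → ℝ}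
    (hP : ∀ ω, 0 ≤ P ω) (X : Ω → A) (Z : Ω → B) (h : ∀ ω ω', X ω = X ω' → Z ω = Z ω') :
    entW P Z ≤ entW P X := by
  rw [entW_eq_sum, entW_eq_sum, neg_le_neg_iff]
  refine Finset.sum_le_sum fun ω _ => ?_
  rcases (hP ω).eq_or_lt with h0 | h0
  · simp [← h0]
  · exact mul_le_mul_of_nonneg_left (Real.log_le_log (h0.trans_le (le_prW hP rfl))
      (prW_mono hP fun ω' => h ω' ω)) h0.le

/-- Gibbs' inequality. -/
theorem entW_le_neg_sum_mul_log {Ω A : Type*} [Fintype Ω] [Fintype A] {P : Ω → ℝ}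
    (hP : ∀ ω, 0 ≤ P ω) (X : Ω → A) (r : A → ℝ) (hr : ∀ a, 0 ≤ r a)
    (hac : ∀ ω, 0 < P ω → 0 < r (X ω)) (hsum : ∑ a, r a ≤ ∑ ω, P ω) :
    entW P X ≤ -∑ ω, P ω * Real.log (r (X ω)) := by
  have hdiff : ∀ a, prW P (fun ω => X ω = a) * (Real.log (r a) -
      Real.log (prW P (fun ω => X ω = a))) ≤ r a - prW P (fun ω => X ω = a) := by
    intro a
    rcases (prW_nonneg hP (fun ω => X ω = a)).eq_or_lt with h0 | h0
    · simp [← h0, hr a]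
    · obtain ⟨ω, hω, hpos⟩ : ∃ ω, X ω = a ∧ 0 < P ω := by
        by_contra! hne
        refine h0.not_ge (Finset.sum_nonpos fun ω _ => ?_)
        split_ifs with hX
        · exact hne ω hX
        · exact le_rfl
      have hra : 0 < r a := hω ▸ hac ω hpos
      rw [← Real.log_div hra.ne' h0.ne']
      calc _ ≤ prW P (fun ω => X ω = a) * (r a / prW P (fun ω => X ω = a) - 1) :=
            mul_le_mul_of_nonneg_left (Real.log_le_sub_one_of_pos (div_pos hra h0)) h0.le
        _ = _ := by field_simp
  have htotal := Finset.sum_le_sum fun a (_ : a ∈ Finset.univ) => hdiff a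
  simp only [mul_sub, Finset.sum_sub_distrib, sum_prW, sum_prW_mul P X (fun a => Real.log (r a))]
    at htotal
  rw [entW]
  linarith

/-- Submodularity of entropy. -/
theorem entW_submodular {Ω A B C : Type*} [Fintype Ω] [Fintype A] [Fintype B] [Fintype C]
    {P : Ω → ℝ} (hP : ∀ ω, 0 ≤ P ω) (X : Ω → A) (Y : Ω → B) (Z : Ω → C) :
    entW P (fun ω => (X ω, Y ω, Z ω)) + entW P X ≤
      entW P (fun ω => (X ω, Y ω)) + entW P (fun ω => (X ω, Z ω)) := by
  have hgibbs := entW_le_neg_sum_mul_log hP (fun ω => (X ω, Y ω, Z ω))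
    (fun t => prW P (fun ω => (X ω, Y ω) = (t.1, t.2.1)) *
      prW P (fun ω => (X ω, Z ω) = (t.1, t.2.2)) / prW P (fun ω => X ω = t.1))
    (fun t => div_nonneg (mul_nonneg (prW_nonneg hP _) (prW_nonneg hP _)) (prW_nonneg hP _))
    (fun ω h => div_pos (mul_pos (h.trans_le (le_prW hP rfl)) (h.trans_le (le_prW hP rfl)))
      (h.trans_le (le_prW hP rfl)))
    (by
      simp only [Fintype.sum_prod_type, ← Finset.sum_div, ← Finset.mul_sum, ← Finset.sum_mul,
        sum_prW_pair, mul_self_div_self, sum_prW, le_refl])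
  refine (add_le_add_left hgibbs _).trans (le_of_eq ?_)
  simp only [entW_eq_sum, ← neg_add, ← Finset.sum_add_distrib]
  congr 1
  refine Finset.sum_congr rfl fun ω _ => ?_
  rcases (hP ω).eq_or_lt with h | h
  · simp [← h]
  · have hX : 0 < prW P (fun ω' => X ω' = X ω) := h.trans_le (le_prW hP rfl)
    have hXY : 0 < prW P (fun ω' => (X ω', Y ω') = (X ω, Y ω)) := h.trans_le (le_prW hP rfl)
    have hXZ : 0 < prW P (fun ω' => (X ω', Z ω') = (X ω, Z ω)) := h.trans_le (le_prW hP rfl)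
    rw [Real.log_div (mul_pos hXY hXZ).ne' hX.ne', Real.log_mul hXY.ne' hXZ.ne']
    ring

theorem entW_pair_le_add_log_card {Ω A B : Type*} [Fintype Ω] [Fintype A] [Fintype B]
    [Nonempty B] {P : Ω → ℝ} (hP : ∀ ω, 0 ≤ P ω) (hP1 : ∑ ω, P ω = 1) (X : Ω → A) (Y : Ω → B) :
    entW P (fun ω => (X ω, Y ω)) ≤ entW P X + Real.log (Fintype.card B) := by
  have hB : (0 : ℝ) < Fintype.card B := by exact_mod_cast Fintype.card_pos
  have hgibbs := entW_le_neg_sum_mul_log hP (fun ω => (X ω, Y ω))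
    (fun t => prW P (fun ω => X ω = t.1) / Fintype.card B)
    (fun t => div_nonneg (prW_nonneg hP _) hB.le)
    (fun ω h => div_pos (h.trans_le (le_prW hP rfl)) hB)
    (by
      simp only [Fintype.sum_prod_type, Finset.sum_const, Finset.card_univ, nsmul_eq_mul,
        mul_div_cancel₀ _ hB.ne', sum_prW, le_refl])
  refine hgibbs.trans (le_of_eq ?_)
  have hlog : ∀ ω, P ω * Real.log (prW P (fun ω' => X ω' = X ω) / Fintype.card B) =
      P ω * Real.log (prW P (fun ω' => X ω' = X ω)) - P ω * Real.log (Fintype.card B) := by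
    intro ω
    rcases (hP ω).eq_or_lt with h | h
    · simp [← h]
    · have hX : 0 < prW P (fun ω' => X ω' = X ω) := h.trans_le (le_prW hP rfl)
      rw [Real.log_div hX.ne' hB.ne', mul_sub]
  simp only [hlog, Finset.sum_sub_distrib, ← Finset.sum_mul, hP1, entW_eq_sum]
  ring

/-- if `(Y3, Y4)` is a deterministic function of `(Y1, Y2)` and `M` is a
deterministic function of `(Y3, Y4)`, then `max_{i,j} I(M; (Y_i, Y_j)) ≥ H(M) - (1/2) log d`;
in particular if `M` is uniform on `Z_d` the maximum is at least `(1/2) log d`, and if all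
four mutual informations vanish then `H(M) ≤ (1/2) log d`. -/
theorem max_leaked_information_lower_bound
    (Ω : Type) [Fintype Ω] (d : ℕ) [NeZero d]
    (P : Ω → ℝ) (hP0 : ∀ ω, 0 ≤ P ω) (hP1 : ∑ ω : Ω, P ω = 1)
    (M : Ω → ZMod d) (Y1 Y2 Y3 Y4 : Ω → ZMod d)
    (hdet : ∃ f : ZMod d × ZMod d → ZMod d × ZMod d,
      ∀ ω, (Y3 ω, Y4 ω) = f (Y1 ω, Y2 ω))
    (hrec : ∃ g : ZMod d × ZMod d → ZMod d, ∀ ω, M ω = g (Y3 ω, Y4 ω)) :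
    (entW P M - (1 / 2) * Real.log d ≤
      max (max (miW P M (fun ω => (Y1 ω, Y3 ω))) (miW P M (fun ω => (Y1 ω, Y4 ω))))
          (max (miW P M (fun ω => (Y2 ω, Y3 ω))) (miW P M (fun ω => (Y2 ω, Y4 ω))))) ∧
    ((∀ a : ZMod d, prW P (fun ω => M ω = a) = 1 / d) →
      (1 / 2) * Real.log d ≤
        max (max (miW P M (fun ω => (Y1 ω, Y3 ω))) (miW P M (fun ω => (Y1 ω, Y4 ω))))
            (max (miW P M (fun ω => (Y2 ω, Y3 ω))) (miW P M (fun ω => (Y2 ω, Y4 ω))))) ∧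
    ((miW P M (fun ω => (Y1 ω, Y3 ω)) = 0 ∧ miW P M (fun ω => (Y1 ω, Y4 ω)) = 0 ∧
      miW P M (fun ω => (Y2 ω, Y3 ω)) = 0 ∧ miW P M (fun ω => (Y2 ω, Y4 ω)) = 0) →
      entW P M ≤ (1 / 2) * Real.log d) := by
  have hmax : entW P M - (1 / 2) * Real.log d ≤
      max (max (miW P M (fun ω => (Y1 ω, Y3 ω))) (miW P M (fun ω => (Y1 ω, Y4 ω))))
          (max (miW P M (fun ω => (Y2 ω, Y3 ω))) (miW P M (fun ω => (Y2 ω, Y4 ω)))) := by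
    obtain ⟨f, hf⟩ := hdet
    obtain ⟨g, hg⟩ := hrec
    refine le_trans ?_ (le_max_left _ _)
    have h3 : entW P (fun ω => (M ω, Y1 ω, Y3 ω)) ≤ entW P (fun ω => (Y1 ω, Y3 ω, Y4 ω)) :=
      entW_le_of_determined hP0 _ _ fun ω ω' h => by
        simp only [Prod.mk.injEq] at h
        simp only [hg, h]
    have h4 : entW P (fun ω => (M ω, Y1 ω, Y4 ω)) ≤ entW P (fun ω => (Y1 ω, Y3 ω, Y4 ω)) :=
      entW_le_of_determined hP0 _ _ fun ω ω' h => by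
        simp only [Prod.mk.injEq] at h
        simp only [hg, h]
    have h12 : entW P (fun ω => (Y1 ω, Y3 ω, Y4 ω)) ≤ entW P (fun ω => (Y1 ω, Y2 ω)) :=
      entW_le_of_determined hP0 _ _ fun ω ω' h => by
        simp only [Prod.mk.injEq] at h
        simp only [hf, h]
    have hsub := entW_submodular hP0 Y1 Y3 Y4
    have hcard := entW_pair_le_add_log_card hP0 hP1 Y1 Y2
    rw [ZMod.card] at hcard
    by_contra! hlt
    obtain ⟨hlt3, hlt4⟩ := max_lt_iff.mp hlt
    unfold miW at hlt3 hlt4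
    linarith
  refine ⟨hmax, fun hunif => ?_, fun ⟨h13, h14, h23, h24⟩ => ?_⟩
  · have hM : entW P M = Real.log d := by
      have hd : (d : ℝ) ≠ 0 := NeZero.ne _
      simp [entW, hunif, hd]
    linarith
  · simp only [h13, h14, h23, h24, max_self] at hmax
    linarith
end
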